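/- The columns of the m×m matrix B with B having the (m-1)×(m-1) identity matrix in the top-left block, zeros in the top-right column except the last entry which is 1+ω, and bottom row (ω, ω, ..., ω, 1+ω), form a Z[ω]-basis of E_m = {(x_1,...,x_m) ∈ Z[ω]^m : Σ x_k ∈ (1+ω)Z[ω]}. -/

import Mathlib

noncomputable def ω : ℂ := (1 + Real.sqrt 3 * Complex.I) / 2

def Zω : Set ℂ := {x | ∃ a b : ℤ, x = (a : ℂ) + (b : ℂ) * ω}

def idealω : Set ℂ := {x | ∃ z ∈ Zω, x = (1 + ω) * z}

def Em (m : ℕ) : Set (Fin m → ℂ) :=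
  {x | (∀ k, x k ∈ Zω) ∧ (∑ k, x k) ∈ idealω}

/-- The columns of B_{E_m}: b_k = e_k + ω e_m for k < m, b_m = (1+ω) e_m. -/
noncomputable def bE (m : ℕ) : Fin (m + 1) → (Fin (m + 1) → ℂ) := fun k i =>
  if k = Fin.last m then (if i = Fin.last m then 1 + ω else 0)
  else (if i = k then 1 else if i = Fin.last m then ω else 0)

theorem omega_sq : ω ^ 2 = ω - 1 := by
  have h3 : (Real.sqrt 3 : ℂ) ^ 2 = 3 := by
    rw [← Complex.ofReal_pow, Real.sq_sqrt (by norm_num)]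
    norm_num
  unfold ω
  linear_combination (1 / 4 : ℂ) * Complex.I ^ 2 * h3 + (3 / 4 : ℂ) * Complex.I_sq

theorem one_add_omega_ne_zero : 1 + ω ≠ 0 := by
  intro h
  have h3 : (3 : ℂ) = 0 := by linear_combination (2 - ω) * h + omega_sq
  norm_num at h3

/-- The Eisenstein integers as a subring of `ℂ`. -/
noncomputable def eisensteinSubring : Subring ℂ where
  carrier := Zω
  zero_mem' := ⟨0, 0, by simp⟩
  one_mem' := ⟨1, 0, by simp⟩
  add_mem' := by
    rintro _ _ ⟨a, b, rfl⟩ ⟨c, d, rfl⟩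
    exact ⟨a + c, b + d, by push_cast; ring⟩
  neg_mem' := by
    rintro _ ⟨a, b, rfl⟩
    exact ⟨-a, -b, by push_cast; ring⟩
  mul_mem' := by
    rintro _ _ ⟨a, b, rfl⟩ ⟨c, d, rfl⟩
    refine ⟨a * c - b * d, a * d + b * c + b * d, ?_⟩
    push_cast
    linear_combination (b * d : ℂ) * omega_sq

theorem mem_eisensteinSubring {x : ℂ} : x ∈ eisensteinSubring ↔ x ∈ Zω := Iff.rfl

theorem omega_mem_eisensteinSubring : ω ∈ eisensteinSubring := ⟨0, 1, by simp⟩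

theorem sum_smul_bE_castSucc (m : ℕ) (c : Fin (m + 1) → ℂ) (i : Fin m) :
    (∑ k, c k • bE m k) i.castSucc = c i.castSucc := by
  simp [Fin.sum_univ_castSucc, bE, Fin.castSucc_ne_last]

theorem sum_smul_bE_last (m : ℕ) (c : Fin (m + 1) → ℂ) :
    (∑ k, c k • bE m k) (Fin.last m) =
      ω * ∑ i : Fin m, c i.castSucc + (1 + ω) * c (Fin.last m) := by
  simp [Fin.sum_univ_castSucc, bE, Fin.castSucc_ne_last, (Fin.castSucc_ne_last _).symm,
    Finset.mul_sum, mul_comm]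

theorem linearIndependent_bE (m : ℕ) : LinearIndependent ℂ (bE m) := by
  rw [Fintype.linearIndependent_iff]
  intro c hc
  have hinit (i : Fin m) : c i.castSucc = 0 := by
    rw [← sum_smul_bE_castSucc m c, hc, Pi.zero_apply]
  have hlast := sum_smul_bE_last m c
  simp only [hc, hinit, Pi.zero_apply, Finset.sum_const_zero, mul_zero, zero_add] at hlast
  exact Fin.lastCases ((mul_eq_zero.mp hlast.symm).resolve_left one_add_omega_ne_zero) hinit

/-- The columns of B_{E_m} form a Z[ω]-basis of E_m: they are linearly independent
and their Z[ω]-span equals E_m. -/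
theorem stmt6 (m : ℕ) :
    LinearIndependent ℂ (bE m) ∧
    {x | ∃ c : Fin (m + 1) → ℂ, (∀ k, c k ∈ Zω) ∧ x = ∑ k, c k • bE m k}
      = Em (m + 1) := by
  refine ⟨linearIndependent_bE m, Set.ext fun x => ⟨?_, ?_⟩⟩
  · rintro ⟨c, hc, rfl⟩
    have hc' (k : Fin (m + 1)) : c k ∈ eisensteinSubring := hc k
    refine ⟨fun k => ?_, ∑ k, c k, eisensteinSubring.sum_mem fun k _ => hc' k, ?_⟩
    · rw [← mem_eisensteinSubring]
      induction k using Fin.lastCases with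
      | last =>
        rw [sum_smul_bE_last]
        exact add_mem (mul_mem omega_mem_eisensteinSubring (sum_mem fun i _ => hc' _))
          (mul_mem (add_mem (one_mem _) omega_mem_eisensteinSubring) (hc' _))
      | cast i =>
        rw [sum_smul_bE_castSucc]
        exact hc' _
    · rw [Fin.sum_univ_castSucc, sum_smul_bE_last, Fin.sum_univ_castSucc c]
      simp only [sum_smul_bE_castSucc]
      ring
  · rintro ⟨hx, z, hz, hsum⟩
    have hx' (k : Fin (m + 1)) : x k ∈ eisensteinSubring := hx k
    have hz' : z ∈ eisensteinSubring := hz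
    refine ⟨Fin.lastCases (z - ∑ i : Fin m, x i.castSucc) fun i => x i.castSucc,
      fun k => ?_, funext fun k => ?_⟩
    · rw [← mem_eisensteinSubring]
      induction k using Fin.lastCases with
      | last =>
        simp only [Fin.lastCases_last]
        exact sub_mem hz' (sum_mem fun i _ => hx' _)
      | cast i =>
        simp only [Fin.lastCases_castSucc]
        exact hx' _
    · induction k using Fin.lastCases with
      | last =>
        rw [sum_smul_bE_last]
        simp only [Fin.lastCases_last, Fin.lastCases_castSucc]
        rw [Fin.sum_univ_castSucc] at hsum
        linear_combination hsum
      | cast i => rw [sum_smul_bE_castSucc, Fin.lastCases_castSucc]
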